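/- Equivalence of causal and causal quasi-Markov problems: Let μ be a Markov probability measure on ℝ^N and let the cost be semiseparable, c(x,y) = Σ_{t≤N} c_t(x_t, y₁,…,y_t) with Borel c_t bounded below. Then inf_{γ ∈ Π_cqm(μ,ν)} ∫ c dγ = inf_{γ ∈ Π_c(μ,ν)} ∫ c dγ, and if the causal problem is attained then there exists an optimal causal transport plan which is moreover causal quasi-Markov. -/

import Mathlib

open MeasureTheory ProbabilityTheory Set Filter
open scoped ENNReal NNReal BoundedContinuousFunction

noncomputable section

namespace CausalTransport

/-- The path space of a real-valued process in `N` time steps. -/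
abbrev Path (N : ℕ) := Fin N → ℝ

/-- Truncation of a path to its first `t` coordinates. -/
def proj (N t : ℕ) (x : Path N) : Fin t → ℝ :=
  fun i => if h : (i : ℕ) < N then x ⟨i, h⟩ else 0

/-- The coordinate with (0-based) index `t`, with junk value `0` if `t ≥ N`. -/
def coord (N t : ℕ) (x : Path N) : ℝ := if h : t < N then x ⟨t, h⟩ else 0

/-- The coordinates of a path after time `t`. -/
def tailProj (N t : ℕ) (x : Path N) : Fin (N - t) → ℝ := fun i => coord N (t + i) x

/-- Extension of a history of length `t` by one further value. -/
def snocFun (t : ℕ) (xs : Fin t → ℝ) (r : ℝ) : Fin (t + 1) → ℝ :=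
  fun i => if h : (i : ℕ) < t then xs ⟨i, h⟩ else r

/-- Extension of a history of length `t` to a full path (by `0`). -/
def pad (N t : ℕ) (xs : Fin t → ℝ) : Path N :=
  fun i => if h : (i : ℕ) < t then xs ⟨i, h⟩ else 0

/-- Glue the first `t` coordinates of `x` with the later coordinates `z`. -/
def glue (N t : ℕ) (x : Path N) (z : Fin (N - t) → ℝ) : Path N :=
  fun i => if (i : ℕ) < t then x i else
    if h : (i : ℕ) - t < N - t then z ⟨(i : ℕ) - t, h⟩ else 0

/-- Truncation of a pair of paths to the first `t` coordinates of each. -/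
def pairProj (N t : ℕ) (p : Path N × Path N) : (Fin t → ℝ) × (Fin t → ℝ) :=
  (proj N t p.1, proj N t p.2)

/-- The σ-algebra on path space generated by the first `t` coordinates. -/
def filt (N t : ℕ) : MeasurableSpace (Path N) :=
  MeasurableSpace.comap (proj N t) inferInstance

/-- `γ` is a transport plan (coupling) between `μ` and `ν`. -/
def IsCoupling {α β : Type*} [MeasurableSpace α] [MeasurableSpace β]
    (μ : Measure α) (ν : Measure β) (γ : Measure (α × β)) : Prop :=
  γ.map Prod.fst = μ ∧ γ.map Prod.snd = ν

/-- `γ` is a causal transport plan between `μ` and `ν`: it is a coupling and, for any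
disintegration `K` of `γ` over its first coordinate and any `t ∈ {1,…,N}`, the map
`x ↦ K x B` is measurable for the σ-algebra of the first `t` coordinates (up to `μ`-null
sets) whenever `B` is measurable for the first `t` coordinates. -/
def IsCausal (N : ℕ) (μ ν : Measure (Path N)) (γ : Measure (Path N × Path N)) : Prop :=
  IsCoupling μ ν γ ∧
  ∀ K : Kernel (Path N) (Path N), IsSFiniteKernel K → μ ⊗ₘ K = γ →
    ∀ t : ℕ, 1 ≤ t → t ≤ N → ∀ B : Set (Path N), MeasurableSet[filt N t] B →
      ∃ g : Path N → ℝ≥0∞, Measurable[filt N t] g ∧ (fun x => K x B) =ᵐ[μ] g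

/-- `γ` is a bicausal transport plan between `μ` and `ν`. -/
def IsBicausal (N : ℕ) (μ ν : Measure (Path N)) (γ : Measure (Path N × Path N)) : Prop :=
  IsCausal N μ ν γ ∧ IsCausal N ν μ (γ.map Prod.swap)

/-- Regular conditional distribution, under `μ`, of the coordinate of index `t`
given the first `t` coordinates. -/
def nextK (N : ℕ) (μ : Measure (Path N)) [IsFiniteMeasure μ] (t : ℕ) :
    Kernel (Fin t → ℝ) ℝ :=
  (μ.map (fun x => (proj N t x, coord N t x))).condKernel

/-- Regular conditional distribution, under `μ`, of all the coordinates after time `t`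
given the first `t` coordinates. -/
def tailK (N : ℕ) (μ : Measure (Path N)) [IsFiniteMeasure μ] (t : ℕ) :
    Kernel (Fin t → ℝ) (Fin (N - t) → ℝ) :=
  (μ.map (fun x => (proj N t x, tailProj N t x))).condKernel

/-- Regular conditional distribution, under `γ`, of the pair of coordinates of index `t`
given the first `t` coordinates of both paths. -/
def stepK (N : ℕ) (γ : Measure (Path N × Path N)) [IsFiniteMeasure γ] (t : ℕ) :
    Kernel ((Fin t → ℝ) × (Fin t → ℝ)) (ℝ × ℝ) :=
  (γ.map (fun p => (pairProj N t p, (coord N t p.1, coord N t p.2)))).condKernel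

/-- Regular conditional distribution, under `μ`, of the coordinate of index `t` given the
single coordinate of index `t-1` (one-step Markov transition kernel). -/
def mstep (N : ℕ) (μ : Measure (Path N)) [IsFiniteMeasure μ] (t : ℕ) : Kernel ℝ ℝ :=
  (μ.map (fun x => (coord N (t - 1) x, coord N t x))).condKernel

/-- `μ` is a Markov measure. -/
def IsMarkovMeasure (N : ℕ) (μ : Measure (Path N)) [IsFiniteMeasure μ] : Prop :=
  ∀ (t : ℕ) (ht : 1 ≤ t) (_ : t < N),
    ∀ᵐ xs ∂(μ.map (proj N t)), nextK N μ t xs = mstep N μ t (xs ⟨t - 1, by omega⟩)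

/-- A causal plan is causal quasi-Markov if (every version of) the conditional law of
`(x_{t+1}, y_{t+1})` given `(x_1,…,x_t,y_1,…,y_t)` depends a.s. only on `(x_t, y_1,…,y_t)`. -/
def IsQuasiMarkov (N : ℕ) (γ : Measure (Path N × Path N)) : Prop :=
  ∀ (t : ℕ) (ht : 1 ≤ t) (_ : t < N),
    ∀ S : Kernel ((Fin t → ℝ) × (Fin t → ℝ)) (ℝ × ℝ), IsSFiniteKernel S →
      (γ.map (pairProj N t)) ⊗ₘ S
          = γ.map (fun p => (pairProj N t p, (coord N t p.1, coord N t p.2))) →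
      ∃ κ : Kernel (ℝ × (Fin t → ℝ)) (ℝ × ℝ),
        ∀ᵐ z ∂(γ.map (pairProj N t)), S z = κ (z.1 ⟨t - 1, by omega⟩, z.2)

/-- Topological support of a measure. -/
def msupport {α : Type*} [TopologicalSpace α] [MeasurableSpace α] (μ : Measure α) : Set α :=
  {x | ∀ U : Set α, IsOpen U → x ∈ U → μ U ≠ 0}

/-- `K` is a version of the disintegration of `μ` at time `t` which is weakly continuous on
the support of the first `t` coordinates of `μ`. -/
def WeaklyContinuousDisintegration (N t : ℕ) (μ : Measure (Path N))
    (K : Kernel (Fin t → ℝ) (Fin (N - t) → ℝ)) : Prop :=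
  IsMarkovKernel K ∧
  (μ.map (proj N t)) ⊗ₘ K = μ.map (fun x => (proj N t x, tailProj N t x)) ∧
  ∀ f : (Fin (N - t) → ℝ) →ᵇ ℝ,
    ContinuousOn (fun xs => ∫ z, f z ∂(K xs)) (msupport (μ.map (proj N t)))

/-- `μ` is successively weakly continuous. -/
def SuccWeakCont (N : ℕ) (μ : Measure (Path N)) : Prop :=
  ∀ t : ℕ, t < N → ∃ K : Kernel (Fin t → ℝ) (Fin (N - t) → ℝ),
    WeaklyContinuousDisintegration N t μ K

/-- The cumulative distribution function of a measure on `ℝ`. -/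
def cdf1 (η : Measure ℝ) (z : ℝ) : ℝ := (η (Iic z)).toReal

/-- The left-continuous generalized inverse (quantile function) of the c.d.f. of `η`. -/
def qinv (η : Measure ℝ) (u : ℝ) : ℝ := sInf {y : ℝ | u ≤ cdf1 η y}

/-- Partial Knothe–Rosenblatt path built from the "uniform" inputs `u`. -/
def krPartial (N : ℕ) (μ : Measure (Path N)) [IsFiniteMeasure μ] (u : ℕ → ℝ) :
    (t : ℕ) → Fin t → ℝ
  | 0 => Fin.elim0
  | t + 1 => snocFun t (krPartial N μ u t)
      (qinv (nextK N μ t (krPartial N μ u t)) (u t))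

/-- The Knothe–Rosenblatt (quantile transform) path built from uniform inputs. -/
def krPath (N : ℕ) (μ : Measure (Path N)) [IsFiniteMeasure μ] (u : Path N) : Path N :=
  krPartial N μ (fun n => if h : n < N then u ⟨n, h⟩ else 0) N

/-- The uniform distribution on `[0,1]`. -/
def unif01 : Measure ℝ := volume.restrict (Icc (0 : ℝ) 1)

instance : IsProbabilityMeasure unif01 := by
  constructor
  simp [unif01, Real.volume_Icc]

/-- N independent uniforms on `[0,1]`. -/
def uniformCube (N : ℕ) : Measure (Path N) := Measure.pi fun _ => unif01

instance (N : ℕ) : IsProbabilityMeasure (uniformCube N) :=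
  inferInstanceAs (IsProbabilityMeasure (Measure.pi fun _ : Fin N => unif01))

/-- The (increasing) Knothe–Rosenblatt rearrangement of `(μ, ν)`: the joint law of
`(X*, Y*)` where both paths are built from the same independent uniforms. -/
def krCoupling (N : ℕ) (μ ν : Measure (Path N)) [IsFiniteMeasure μ] [IsFiniteMeasure ν] :
    Measure (Path N × Path N) :=
  (uniformCube N).map (fun u => (krPath N μ u, krPath N ν u))

/-- Partial Knothe–Rosenblatt Monge map. -/
def krMapPartial (N : ℕ) (μ ν : Measure (Path N)) [IsFiniteMeasure μ] [IsFiniteMeasure ν]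
    (x : Path N) : (t : ℕ) → Fin t → ℝ
  | 0 => Fin.elim0
  | t + 1 => snocFun t (krMapPartial N μ ν x t)
      (qinv (nextK N ν t (krMapPartial N μ ν x t))
        (cdf1 (nextK N μ t (proj N t x)) (coord N t x)))

/-- The Knothe–Rosenblatt Monge map from `μ` to `ν`. -/
def krMap (N : ℕ) (μ ν : Measure (Path N)) [IsFiniteMeasure μ] [IsFiniteMeasure ν]
    (x : Path N) : Path N :=
  krMapPartial N μ ν x N

open Classical in
/-- Relative entropy `Ent(ν|μ)`, via the nonnegative integrand `f log f - f + 1`,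
`f = dν/dμ`; equals `∫ log (dν/dμ) dν` for probability measures. -/
def relEnt {α : Type*} [MeasurableSpace α] (ν μ : Measure α) : ℝ≥0∞ :=
  if ν ≪ μ then
    ∫⁻ x, ENNReal.ofReal
      ((ν.rnDeriv μ x).toReal * Real.log (ν.rnDeriv μ x).toReal
        - (ν.rnDeriv μ x).toReal + 1) ∂μ
  else ∞

/-- Universally measurable `ℝ≥0∞`-valued function. -/
def UnivMeasurable {α : Type*} [MeasurableSpace α] (f : α → ℝ≥0∞) : Prop :=
  ∀ P : Measure α, IsFiniteMeasure P → AEMeasurable f P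

/-- The semiseparable total cost `∑_{t ≤ N} c_t(x_t, y_1,…,y_t)` (1-based `t`). -/
def semisepCost (N : ℕ) (c : (t : ℕ) → ℝ → (Fin t → ℝ) → ℝ≥0∞)
    (p : Path N × Path N) : ℝ≥0∞ :=
  ∑ t ∈ Finset.Icc 1 N, c t (coord N (t - 1) p.1) (proj N t p.2)

/-- The last coordinate of a history (junk value `0` for the empty history). -/
def lastOf (t : ℕ) (xs : Fin t → ℝ) : ℝ := if h : 0 < t then xs ⟨t - 1, by omega⟩ else 0

/-- The quasi-Markov state: last `x` coordinate together with the `y` history. -/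
def stateZ (t : ℕ) (z : (Fin t → ℝ) × (Fin t → ℝ)) : ℝ × (Fin t → ℝ) := (lastOf t z.1, z.2)

/-- Extension of a pair of histories by a pair of values. -/
def extPair (t : ℕ) (q : ((Fin t → ℝ) × (Fin t → ℝ)) × (ℝ × ℝ)) :
    (Fin (t + 1) → ℝ) × (Fin (t + 1) → ℝ) :=
  (snocFun t q.1.1 q.2.1, snocFun t q.1.2 q.2.2)

@[fun_prop]
lemma measurable_proj (N t : ℕ) : Measurable (proj N t) := by
  refine measurable_pi_lambda _ fun i => ?_
  unfold proj
  split_ifs <;> fun_prop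

@[fun_prop]
lemma measurable_coord (N t : ℕ) : Measurable (coord N t) := by
  unfold coord
  split_ifs <;> fun_prop

@[fun_prop]
lemma measurable_lastOf (t : ℕ) : Measurable (lastOf t) := by
  unfold lastOf
  split_ifs <;> fun_prop

@[fun_prop]
lemma measurable_stateZ (t : ℕ) : Measurable (stateZ t) := by
  unfold stateZ; fun_prop

@[fun_prop]
lemma measurable_pairProj (N t : ℕ) : Measurable (pairProj N t) := by
  unfold pairProj; fun_prop

lemma measurable_snocFun (t : ℕ) :
    Measurable (fun q : (Fin t → ℝ) × ℝ => snocFun t q.1 q.2) := by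
  refine measurable_pi_lambda _ fun i => ?_
  unfold snocFun
  split_ifs <;> fun_prop

@[fun_prop]
lemma measurable_extPair (t : ℕ) : Measurable (extPair t) := by
  unfold extPair
  exact ((measurable_snocFun t).comp (by fun_prop : Measurable
    (fun q : ((Fin t → ℝ) × (Fin t → ℝ)) × (ℝ × ℝ) => (q.1.1, q.2.1)))).prodMk
    ((measurable_snocFun t).comp (by fun_prop : Measurable
    (fun q : ((Fin t → ℝ) × (Fin t → ℝ)) × (ℝ × ℝ) => (q.1.2, q.2.2))))

lemma snoc_proj (N t : ℕ) (x : Path N) : snocFun t (proj N t x) (coord N t x) = proj N (t+1) x := by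
  ext i
  unfold snocFun proj coord
  by_cases h : (i : ℕ) < t
  · simp [h]
  · have : (i : ℕ) = t := by omega
    simp [this]

lemma proj_self (N : ℕ) (x : Path N) : proj N N x = x := by
  ext i; simp [proj]

lemma proj_snoc (T t : ℕ) (h : t ≤ T) (xs : Fin T → ℝ) (r : ℝ) :
    proj (T+1) t (snocFun T xs r) = proj T t xs := by
  ext i
  have h1 : (i : ℕ) < T := by omega
  have h2 : (i : ℕ) < T + 1 := by omega
  simp [proj, snocFun, h1, h2]

lemma proj_snoc_self (t : ℕ) (xs : Fin t → ℝ) (r : ℝ) :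
    proj (t+1) t (snocFun t xs r) = xs := by
  rw [proj_snoc t t le_rfl, proj_self]

lemma coord_snoc_self (t : ℕ) (xs : Fin t → ℝ) (r : ℝ) :
    coord (t+1) t (snocFun t xs r) = r := by
  simp [coord, snocFun]

lemma lastOf_snoc (t : ℕ) (xs : Fin t → ℝ) (r : ℝ) : lastOf (t+1) (snocFun t xs r) = r := by
  simp [lastOf, snocFun]

lemma lastOf_proj (N t : ℕ) (ht : 1 ≤ t) (x : Path N) :
    lastOf t (proj N t x) = coord N (t-1) x := by
  have : 0 < t := ht
  simp [lastOf, proj, coord, this]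

lemma proj_proj (N T t : ℕ) (h : t ≤ T) (x : Path N) : proj T t (proj N T x) = proj N t x := by
  ext i
  have h1 : (i : ℕ) < T := by omega
  simp [proj, h1]

lemma coord_proj (N T t : ℕ) (h : t < T) (x : Path N) : coord T t (proj N T x) = coord N t x := by
  simp [proj, coord, h]

section General
variable {α β δ : Type*} [MeasurableSpace α] [MeasurableSpace β] [MeasurableSpace δ]

lemma compProd_comap_map (m : Measure α) [SFinite m] (f : α → β) (hf : Measurable f)
    (κ : Kernel β δ) [IsSFiniteKernel κ] :
    (m ⊗ₘ κ.comap f hf).map (Prod.map f id) = m.map f ⊗ₘ κ := by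
  ext s hs
  rw [Measure.map_apply (by fun_prop) hs, Measure.compProd_apply (by measurability),
    Measure.compProd_apply hs, lintegral_map (Kernel.measurable_kernel_prodMk_left hs) hf]
  rfl

lemma withDensity_compProd' (m : Measure α) [SFinite m] (g : α → ℝ≥0∞) (hg : Measurable g)
    (κ : Kernel α δ) [IsSFiniteKernel κ] :
    (m.withDensity g) ⊗ₘ κ = (m ⊗ₘ κ).withDensity (fun p => g p.1) := by
  ext s hs
  rw [Measure.compProd_apply hs, withDensity_apply _ hs, ← lintegral_indicator hs,
    Measure.lintegral_compProd (Measurable.indicator (by fun_prop) hs),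
    lintegral_withDensity_eq_lintegral_mul _ hg (Kernel.measurable_kernel_prodMk_left hs)]
  congr with a
  have : (fun b => s.indicator (fun p : α × δ => g p.1) (a, b))
      = (Prod.mk a ⁻¹' s).indicator (fun _ => g a) := by
    ext b; simp only [indicator]; rfl
  rw [this, lintegral_indicator_const (measurable_prodMk_left hs)]
  rfl

lemma map_withDensity_comp (m : Measure α) (f : α → β) (hf : Measurable f)
    (g : β → ℝ≥0∞) (hg : Measurable g) :
    (m.withDensity (fun a => g (f a))).map f = (m.map f).withDensity g := by
  ext s hs
  rw [Measure.map_apply hf hs, withDensity_apply _ (hf hs), withDensity_apply _ hs,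
    setLIntegral_map hs hg hf]

lemma ae_eq_of_compProd_eq_sfinite [MeasurableSpace.CountableOrCountablyGenerated α δ]
    (m : Measure α) [IsFiniteMeasure m] (S κ : Kernel α δ)
    [IsSFiniteKernel S] [IsMarkovKernel κ] (h : m ⊗ₘ S = m ⊗ₘ κ) :
    ∀ᵐ a ∂m, S a = κ a := by
  have h1 : ∀ᵐ a ∂m, S a univ = κ a univ := by
    refine ae_eq_of_forall_setLIntegral_eq_of_sigmaFinite (Kernel.measurable_coe _ .univ)
      (Kernel.measurable_coe _ .univ) fun s hs _ => ?_
    rw [← Measure.compProd_apply_prod hs .univ, ← Measure.compProd_apply_prod hs .univ, h]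
  classical
  have hs : MeasurableSet {a | S a univ = 1} :=
    (Kernel.measurable_coe S .univ) (measurableSet_singleton 1)
  let S' : Kernel α δ := Kernel.piecewise hs S κ
  have hS' : IsMarkovKernel S' := by
    refine ⟨fun a => ⟨?_⟩⟩
    rw [Kernel.piecewise_apply]
    split_ifs with ha
    · exact ha
    · simp
  have hae : ∀ᵐ a ∂m, S a = S' a := by
    filter_upwards [h1] with a ha
    rw [Kernel.piecewise_apply, if_pos]
    simpa using ha
  have h2 : m ⊗ₘ S' = m ⊗ₘ κ := by
    rw [← h]; exact (Measure.compProd_congr hae).symm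
  have h3 := Kernel.ae_eq_of_compProd_eq h2
  filter_upwards [hae, h3] with a ha hb
  rw [ha, hb]

end General

/-- The law of `(x, y)` up to time `t` built from quasi-Markov transition kernels. -/
def gluePlan (S : (t : ℕ) → Kernel (ℝ × (Fin t → ℝ)) (ℝ × ℝ)) :
    (t : ℕ) → Measure ((Fin t → ℝ) × (Fin t → ℝ))
  | 0 => Measure.dirac (Fin.elim0, Fin.elim0)
  | t + 1 => (gluePlan S t ⊗ₘ (S t).comap (stateZ t) (measurable_stateZ t)).map (extPair t)

section Plan
variable (S : (t : ℕ) → Kernel (ℝ × (Fin t → ℝ)) (ℝ × ℝ)) [∀ t, IsMarkovKernel (S t)]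

instance isProb_gluePlan (t : ℕ) : IsProbabilityMeasure (gluePlan S t) := by
  induction t with
  | zero => unfold gluePlan; infer_instance
  | succ t ih =>
    unfold gluePlan
    exact Measure.isProbabilityMeasure_map (by fun_prop)

lemma pairProj_extPair (T t : ℕ) (h : t ≤ T) (q) :
    pairProj (T+1) t (extPair T q) = pairProj T t q.1 := by
  simp [pairProj, extPair, proj_snoc T t h]

lemma gluePlan_map_pairProj (T t : ℕ) (h : t ≤ T) :
    (gluePlan S T).map (pairProj T t) = gluePlan S t := by
  induction T, h using Nat.le_induction with
  | base =>
    have : pairProj t t = id := by ext1 z; simp [pairProj, proj_self]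
    rw [this, Measure.map_id]
  | succ T h ih =>
    rw [gluePlan, Measure.map_map (by fun_prop) (by fun_prop)]
    have : pairProj (T+1) t ∘ extPair T = pairProj T t ∘ Prod.fst := by
      ext1 q; exact pairProj_extPair T t h q
    rw [this, ← Measure.map_map (by fun_prop) (by fun_prop)]
    have h2 := Measure.fst_compProd (gluePlan S T) ((S T).comap (stateZ T) (measurable_stateZ T))
    rw [Measure.fst] at h2
    rw [h2, ih]

lemma gluePlan_step (N t : ℕ) (h : t < N) :
    (gluePlan S N).map (fun p => (pairProj N t p, (coord N t p.1, coord N t p.2)))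
      = gluePlan S t ⊗ₘ (S t).comap (stateZ t) (measurable_stateZ t) := by
  have h1 : (fun p : Path N × Path N => (pairProj N t p, (coord N t p.1, coord N t p.2)))
      = (fun p => (pairProj (t+1) t p, (coord (t+1) t p.1, coord (t+1) t p.2)))
        ∘ pairProj N (t+1) := by
    ext1 p
    simp [pairProj, proj_proj N (t+1) t (by omega), coord_proj N (t+1) t (by omega)]
  rw [h1, ← Measure.map_map (by fun_prop) (by fun_prop), gluePlan_map_pairProj S N (t+1) h,
    gluePlan, Measure.map_map (by fun_prop) (by fun_prop)]
  convert Measure.map_id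
  ext1 q
  simp [pairProj, extPair, proj_snoc_self, coord_snoc_self]

lemma gluePlan_state {N : ℕ} (γ : Measure (Path N × Path N)) [IsProbabilityMeasure γ]
    (hS : ∀ t, γ.map (fun p => (stateZ t (pairProj N t p), (coord N t p.1, coord N t p.2)))
      = γ.map (fun p => stateZ t (pairProj N t p)) ⊗ₘ S t) (t : ℕ) :
    (gluePlan S t).map (stateZ t) = γ.map (fun p => stateZ t (pairProj N t p)) := by
  induction t with
  | zero =>
    have e1 : stateZ 0 = fun _ => (0, Fin.elim0) := by
      ext1 z; simp [stateZ, lastOf]; exact Subsingleton.elim _ _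
    have e2 : IsProbabilityMeasure (gluePlan S 0) := inferInstance
    rw [e1, Measure.map_const, Measure.map_const]
    simp
  | succ t ih =>
    rw [gluePlan, Measure.map_map (by fun_prop) (by fun_prop)]
    let F : (ℝ × (Fin t → ℝ)) × (ℝ × ℝ) → ℝ × (Fin (t+1) → ℝ) :=
      fun q => (q.2.1, snocFun t q.1.2 q.2.2)
    have hF : Measurable F := by
      refine Measurable.prodMk (by fun_prop) ?_
      exact (measurable_snocFun t).comp (by fun_prop :
        Measurable (fun q : (ℝ × (Fin t → ℝ)) × (ℝ × ℝ) => (q.1.2, q.2.2)))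
    have e1 : stateZ (t+1) ∘ extPair t = F ∘ Prod.map (stateZ t) id := by
      ext1 q; simp [stateZ, extPair, F, lastOf_snoc]
    have e2 : (fun p : Path N × Path N => stateZ (t+1) (pairProj N (t+1) p))
        = F ∘ (fun p => (stateZ t (pairProj N t p), (coord N t p.1, coord N t p.2))) := by
      ext1 p
      simp [stateZ, pairProj, F, ← snoc_proj, lastOf_snoc]
    rw [e1, e2, ← Measure.map_map hF (by fun_prop), ← Measure.map_map hF (by fun_prop),
      compProd_comap_map, ih, hS]

/-- The `x` part of one step of the glued plan is the Markov transition of `μ`. -/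
lemma gluePlan_x_step {N : ℕ} (γ : Measure (Path N × Path N)) [IsProbabilityMeasure γ]
    (hS : ∀ t, γ.map (fun p => (stateZ t (pairProj N t p), (coord N t p.1, coord N t p.2)))
      = γ.map (fun p => stateZ t (pairProj N t p)) ⊗ₘ S t) (t : ℕ)
    (M : Kernel ℝ ℝ) [IsMarkovKernel M]
    (hM : γ.map (fun p => (pairProj N t p, coord N t p.1))
      = γ.map (pairProj N t) ⊗ₘ M.comap (fun z => lastOf t z.1) (by fun_prop)) :
    (gluePlan S t ⊗ₘ (S t).comap (stateZ t) (measurable_stateZ t)).map (fun q => (q.1, q.2.1))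
      = gluePlan S t ⊗ₘ M.comap (fun z => lastOf t z.1) (by fun_prop) := by
  have hpp : IsProbabilityMeasure (γ.map (pairProj N t)) :=
    Measure.isProbabilityMeasure_map (by fun_prop)
  have hpp' : IsProbabilityMeasure (γ.map (fun p => stateZ t (pairProj N t p))) :=
    Measure.isProbabilityMeasure_map (by fun_prop)
  have h1 : γ.map (fun p => stateZ t (pairProj N t p)) ⊗ₘ (S t).map Prod.fst
      = γ.map (fun p => stateZ t (pairProj N t p)) ⊗ₘ M.comap Prod.fst measurable_fst := by
    rw [Measure.compProd_map measurable_fst, ← hS, Measure.map_map (by fun_prop) (by fun_prop)]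
    have e : γ.map (fun p => stateZ t (pairProj N t p)) = (γ.map (pairProj N t)).map (stateZ t) := by
      rw [Measure.map_map (by fun_prop) (by fun_prop)]; rfl
    rw [e, ← compProd_comap_map _ _ (measurable_stateZ t)]
    have e2 : (M.comap Prod.fst measurable_fst).comap (stateZ t) (measurable_stateZ t)
      = M.comap (fun z : (Fin t → ℝ) × (Fin t → ℝ) => lastOf t z.1) (by fun_prop) := rfl
    rw [e2, ← hM, Measure.map_map (by fun_prop) (by fun_prop)]
    rfl
  have : IsMarkovKernel ((S t).map Prod.fst) := Kernel.IsMarkovKernel.map _ measurable_fst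
  have h2 := Kernel.ae_eq_of_compProd_eq h1
  rw [← gluePlan_state S γ hS t] at h2
  have h3 := ae_of_ae_map (by fun_prop) h2
  have h4 : gluePlan S t ⊗ₘ ((S t).map Prod.fst).comap (stateZ t) (measurable_stateZ t)
      = gluePlan S t ⊗ₘ M.comap (fun z => lastOf t z.1) (by fun_prop) := by
    refine Measure.compProd_congr ?_
    filter_upwards [h3] with z hz
    simpa [stateZ] using hz
  rw [← h4]
  have e3 : ((S t).map Prod.fst).comap (stateZ t) (measurable_stateZ t)
      = ((S t).comap (stateZ t) (measurable_stateZ t)).map Prod.fst := by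
    ext z s hs
    rw [Kernel.comap_apply, Kernel.map_apply _ measurable_fst, Kernel.map_apply _ measurable_fst,
      Kernel.comap_apply]
  rw [e3, Measure.compProd_map measurable_fst]
  rfl

/-- One step for the `x` marginal restricted to an event in the `y` past. -/
lemma gluePlan_restrict_step (T : ℕ) (M : Kernel ℝ ℝ) [IsMarkovKernel M]
    (hx : (gluePlan S T ⊗ₘ (S T).comap (stateZ T) (measurable_stateZ T)).map
        (fun q => (q.1, q.2.1))
      = gluePlan S T ⊗ₘ M.comap (fun z => lastOf T z.1) (by fun_prop))
    (t : ℕ) (htT : t ≤ T) (B : Set (Fin t → ℝ)) (hB : MeasurableSet B) :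
    ((gluePlan S (T+1)).restrict {p | proj (T+1) t p.2 ∈ B}).map Prod.fst
      = ((((gluePlan S T).restrict {p | proj T t p.2 ∈ B}).map Prod.fst) ⊗ₘ
        M.comap (lastOf T) (measurable_lastOf T)).map (fun q => snocFun T q.1 q.2) := by
  have hC : MeasurableSet {p : Path T × Path T | proj T t p.2 ∈ B} :=
    ((measurable_proj T t).comp measurable_snd) hB
  have hC' : MeasurableSet {p : Path (T+1) × Path (T+1) | proj (T+1) t p.2 ∈ B} :=
    ((measurable_proj (T+1) t).comp measurable_snd) hB
  have hsn := measurable_snocFun T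
  ext A hA
  rw [Measure.map_apply measurable_fst hA, Measure.restrict_apply (measurable_fst hA),
    ← compProd_comap_map _ _ measurable_fst, Measure.map_map hsn (by fun_prop),
    Measure.map_apply (hsn.comp (by fun_prop)) hA]
  have e1 : ((gluePlan S T).restrict {p | proj T t p.2 ∈ B}) ⊗ₘ
      (M.comap (lastOf T) (measurable_lastOf T)).comap Prod.fst measurable_fst
      = (gluePlan S T ⊗ₘ M.comap (fun z : Path T × Path T => lastOf T z.1) (by fun_prop)).restrict
        (Prod.fst ⁻¹' {p | proj T t p.2 ∈ B}) := by
    rw [← withDensity_indicator_one hC, withDensity_compProd' _ _ (measurable_one.indicator hC),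
      ← withDensity_indicator_one (measurable_fst hC)]
    rfl
  rw [e1, ← hx, Measure.restrict_apply ((hsn.comp (by fun_prop)) hA),
    Measure.map_apply (by fun_prop)
      (((hsn.comp (by fun_prop)) hA).inter (measurable_fst hC)), gluePlan,
      Measure.map_apply (by fun_prop) ((measurable_fst hA).inter hC')]
  congr 1
  ext q
  simp [extPair, proj_snoc T t htT]

end Plan

/-- Analytic characterization of causality. -/
lemma IsCausal.density {N : ℕ} {μ ν : Measure (Path N)} [IsProbabilityMeasure μ]
    {γ : Measure (Path N × Path N)} [IsProbabilityMeasure γ]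
    (h : IsCausal N μ ν γ) (t : ℕ) (htN : t ≤ N)
    (B : Set (Fin t → ℝ)) (hB : MeasurableSet B) :
    ∃ f : (Fin t → ℝ) → ℝ≥0∞, Measurable f ∧
      (γ.restrict {p | proj N t p.2 ∈ B}).map Prod.fst = μ.withDensity (fun x => f (proj N t x)) := by
  have hC : MeasurableSet {p : Path N × Path N | proj N t p.2 ∈ B} :=
    ((measurable_proj N t).comp measurable_snd) hB
  rcases Nat.eq_zero_or_pos t with rfl | ht
  · by_cases h0 : (Fin.elim0 : Fin 0 → ℝ) ∈ B
    · refine ⟨fun _ => 1, measurable_const, ?_⟩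
      have : {p : Path N × Path N | proj N 0 p.2 ∈ B} = univ := by
        ext p
        simp only [mem_ofPred_eq, mem_univ, iff_true]
        convert h0
      rw [this, Measure.restrict_univ, h.1.1]
      exact withDensity_one.symm
    · refine ⟨fun _ => 0, measurable_const, ?_⟩
      have : {p : Path N × Path N | proj N 0 p.2 ∈ B} = ∅ := by
        ext p
        simp only [mem_ofPred_eq, mem_empty_iff_false, iff_false]
        convert h0
      rw [this]
      simp
  · have hfst : γ.fst = μ := h.1.1
    have hK : μ ⊗ₘ γ.condKernel = γ := by
      rw [← hfst]; exact γ.disintegrate γ.condKernel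
    obtain ⟨g, hg, hge⟩ := h.2 γ.condKernel inferInstance hK t ht htN (proj N t ⁻¹' B) ⟨B, hB, rfl⟩
    obtain ⟨f, hf, hgf⟩ := Measurable.exists_eq_measurable_comp hg
    refine ⟨f, hf, ?_⟩
    ext A hA
    rw [Measure.map_apply measurable_fst hA, Measure.restrict_apply (measurable_fst hA),
      withDensity_apply _ hA]
    have : Prod.fst ⁻¹' A ∩ {p : Path N × Path N | proj N t p.2 ∈ B} = A ×ˢ (proj N t ⁻¹' B) := rfl
    rw [this]
    conv_lhs => rw [← hK]
    rw [Measure.compProd_apply_prod hA (measurable_proj N t hB)]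
    refine lintegral_congr_ae (ae_restrict_of_ae ?_)
    filter_upwards [hge] with x hx
    rw [hx, hgf]; rfl

lemma isCausal_of_density {N : ℕ} {μ ν : Measure (Path N)} [IsProbabilityMeasure μ]
    {γ : Measure (Path N × Path N)} (hc : IsCoupling μ ν γ)
    (h : ∀ t ≤ N, ∀ B : Set (Fin t → ℝ), MeasurableSet B →
      ∃ f : (Fin t → ℝ) → ℝ≥0∞, Measurable f ∧
      (γ.restrict {p | proj N t p.2 ∈ B}).map Prod.fst
        = μ.withDensity (fun x => f (proj N t x))) :
    IsCausal N μ ν γ := by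
  refine ⟨hc, fun K hKs hK t _ htN B' hB' => ?_⟩
  obtain ⟨B, hB, rfl⟩ := hB'
  obtain ⟨f, hf, hfe⟩ := h t htN B hB
  refine ⟨fun x => f (proj N t x), hf.comp (comap_measurable _), ?_⟩
  have hB2 := measurable_proj N t hB
  refine ae_eq_of_forall_setLIntegral_eq_of_sigmaFinite (Kernel.measurable_coe _ hB2)
    (by fun_prop) fun A hA _ => ?_
  rw [← Measure.compProd_apply_prod hA hB2, ← withDensity_apply _ hA, ← hfe,
    Measure.map_apply measurable_fst hA, Measure.restrict_apply (measurable_fst hA), hK]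
  rfl

/-- Under a causal plan the next `x` coordinate depends on both pasts through the `x` past only. -/
lemma causal_next {N : ℕ} {μ ν : Measure (Path N)} [IsProbabilityMeasure μ]
    {γ : Measure (Path N × Path N)} [IsProbabilityMeasure γ]
    (h : IsCausal N μ ν γ) (t : ℕ) (htN : t ≤ N) (M : Kernel ℝ ℝ) [IsMarkovKernel M]
    (hM : μ.map (fun x => (proj N t x, coord N t x))
      = μ.map (proj N t) ⊗ₘ M.comap (lastOf t) (by fun_prop)) :
    γ.map (fun p => (pairProj N t p, coord N t p.1))
      = γ.map (pairProj N t) ⊗ₘ M.comap (fun z => lastOf t z.1) (by fun_prop) := by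
  have hpp : IsProbabilityMeasure (γ.map (pairProj N t)) :=
    Measure.isProbabilityMeasure_map (by fun_prop)
  have hpm : IsProbabilityMeasure (μ.map (proj N t)) :=
    Measure.isProbabilityMeasure_map (by fun_prop)
  have : IsProbabilityMeasure (γ.map (fun p => (pairProj N t p, coord N t p.1))) :=
    Measure.isProbabilityMeasure_map (by fun_prop)
  refine Measure.ext_prod₃' fun {A B D} hA hB hD => ?_
  obtain ⟨f, hf, hfe⟩ := h.density t htN B hB
  have hC : MeasurableSet {p : Path N × Path N | proj N t p.2 ∈ B} :=
    ((measurable_proj N t).comp measurable_snd) hB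
  set Q := (γ.restrict {p | proj N t p.2 ∈ B}).map Prod.fst with hQ
  have key : Q.map (fun x => (proj N t x, coord N t x))
      = Q.map (proj N t) ⊗ₘ M.comap (lastOf t) (by fun_prop) := by
    rw [hfe, map_withDensity_comp μ (proj N t) (by fun_prop) f hf, withDensity_compProd' _ _ hf,
      ← hM]
    exact map_withDensity_comp μ (fun x => (proj N t x, coord N t x)) (by fun_prop)
      (fun q => f q.1) (by fun_prop)
  have key2 : Q.map (fun x => (proj N t x, coord N t x)) (A ×ˢ D)
      = (Q.map (proj N t) ⊗ₘ M.comap (lastOf t) (by fun_prop)) (A ×ˢ D) := by rw [key]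
  rw [Measure.compProd_apply_prod hA hD, Measure.map_apply (by fun_prop) (hA.prod hD), hQ,
    Measure.map_apply measurable_fst (by measurability),
    Measure.restrict_apply (by measurability),
    Measure.map_map (by fun_prop) (by fun_prop),
    setLIntegral_map hA (Kernel.measurable_coe _ hD) (by fun_prop),
    Measure.restrict_restrict (by measurability)] at key2
  rw [Measure.compProd_apply_prod (hA.prod hB) hD,
    Measure.map_apply (by fun_prop) ((hA.prod hB).prod hD),
    setLIntegral_map (hA.prod hB) (Kernel.measurable_coe _ hD) (by fun_prop)]
  have e1 : (fun p : Path N × Path N => (pairProj N t p, coord N t p.1)) ⁻¹' ((A ×ˢ B) ×ˢ D)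
      = Prod.fst ⁻¹' ((fun x => (proj N t x, coord N t x)) ⁻¹' (A ×ˢ D))
        ∩ {p | proj N t p.2 ∈ B} := by
    ext p
    simp [pairProj]
    tauto
  rw [e1]
  exact key2

lemma markov_kernel {N : ℕ} {μ : Measure (Path N)} [IsProbabilityMeasure μ]
    (hM : IsMarkovMeasure N μ) (t : ℕ) (ht : t < N) :
    ∃ M : Kernel ℝ ℝ, IsMarkovKernel M ∧ μ.map (fun x => (proj N t x, coord N t x))
      = μ.map (proj N t) ⊗ₘ M.comap (lastOf t) (by fun_prop) := by
  have hp : IsProbabilityMeasure (μ.map (proj N t)) :=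
    Measure.isProbabilityMeasure_map (by fun_prop)
  have hp1 : IsProbabilityMeasure (μ.map (fun x => (proj N t x, coord N t x))) :=
    Measure.isProbabilityMeasure_map (by fun_prop)
  have hdis : μ.map (proj N t) ⊗ₘ nextK N μ t = μ.map (fun x => (proj N t x, coord N t x)) := by
    have h1 := (μ.map (fun x => (proj N t x, coord N t x))).disintegrate
      (μ.map (fun x => (proj N t x, coord N t x))).condKernel
    rw [Measure.fst_map_prodMk (by fun_prop)] at h1
    exact h1
  have i1 : IsMarkovKernel (nextK N μ t) := by unfold nextK; infer_instance
  rcases Nat.eq_zero_or_pos t with rfl | h0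
  · refine ⟨(nextK N μ 0).comap (fun _ => Fin.elim0) measurable_const, inferInstance, ?_⟩
    rw [← hdis]
    congr 1
    ext1 z
    rw [Kernel.comap_apply, Kernel.comap_apply]
    congr 1
    exact Subsingleton.elim _ _
  · have i2 : IsMarkovKernel (mstep N μ t) := by
      have : IsProbabilityMeasure (μ.map (fun x => (coord N (t-1) x, coord N t x))) :=
        Measure.isProbabilityMeasure_map (by fun_prop)
      unfold mstep; infer_instance
    refine ⟨mstep N μ t, i2, ?_⟩
    rw [← hdis]
    refine Measure.compProd_congr ?_
    filter_upwards [hM t h0 ht] with xs hxs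
    rw [hxs, Kernel.comap_apply]
    simp [lastOf, h0]

/-- Main construction: every causal plan has a quasi-Markov causal plan with equal cost. -/
lemma exists_quasiMarkov {N : ℕ} {μ ν : Measure (Path N)} [IsProbabilityMeasure μ]
    (hM : IsMarkovMeasure N μ)
    (c : (t : ℕ) → ℝ → (Fin t → ℝ) → ℝ≥0∞)
    (hc : ∀ t, Measurable (fun q : ℝ × (Fin t → ℝ) => c t q.1 q.2))
    (γ : Measure (Path N × Path N)) (hγ : IsCausal N μ ν γ) :
    ∃ γ' : Measure (Path N × Path N), IsCausal N μ ν γ' ∧ IsQuasiMarkov N γ' ∧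
      ∫⁻ p, semisepCost N c p ∂γ' = ∫⁻ p, semisepCost N c p ∂γ := by
  have iγ : IsProbabilityMeasure γ := by
    refine ⟨?_⟩
    have h1 : γ.map Prod.fst univ = μ univ := by rw [hγ.1.1]
    rw [Measure.map_apply measurable_fst .univ] at h1
    simpa using h1
  have iZ (t : ℕ) : IsProbabilityMeasure
      (γ.map (fun p => (stateZ t (pairProj N t p), (coord N t p.1, coord N t p.2)))) :=
    Measure.isProbabilityMeasure_map (by fun_prop)
  let S : (t : ℕ) → Kernel (ℝ × (Fin t → ℝ)) (ℝ × ℝ) := fun t =>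
    (γ.map (fun p => (stateZ t (pairProj N t p), (coord N t p.1, coord N t p.2)))).condKernel
  have iS (t : ℕ) : IsMarkovKernel (S t) := by dsimp only [S]; infer_instance
  have hS : ∀ t, γ.map (fun p => (stateZ t (pairProj N t p), (coord N t p.1, coord N t p.2)))
      = γ.map (fun p => stateZ t (pairProj N t p)) ⊗ₘ S t := by
    intro t
    have h1 := (γ.map (fun p => (stateZ t (pairProj N t p), (coord N t p.1, coord N t p.2)))
      ).disintegrate (S t)
    rw [Measure.fst_map_prodMk (by fun_prop)] at h1
    exact h1.symm
  have hxs : ∀ t < N, ∃ M : Kernel ℝ ℝ, IsMarkovKernel M ∧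
      μ.map (fun x => (proj N t x, coord N t x))
        = μ.map (proj N t) ⊗ₘ M.comap (lastOf t) (by fun_prop) ∧
      (gluePlan S t ⊗ₘ (S t).comap (stateZ t) (measurable_stateZ t)).map (fun q => (q.1, q.2.1))
      = gluePlan S t ⊗ₘ M.comap (fun z => lastOf t z.1) (by fun_prop) := by
    intro t ht
    obtain ⟨M, iM, hMt⟩ := markov_kernel hM t ht
    exact ⟨M, iM, hMt, gluePlan_x_step S γ hS t M (causal_next hγ t ht.le M hMt)⟩
  have hmuStep : ∀ t, ∀ M : Kernel ℝ ℝ, μ.map (fun x => (proj N t x, coord N t x))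
        = μ.map (proj N t) ⊗ₘ M.comap (lastOf t) (by fun_prop) →
      μ.map (proj N (t+1)) = (μ.map (proj N t) ⊗ₘ M.comap (lastOf t) (by fun_prop)).map
        (fun q => snocFun t q.1 q.2) := by
    intro t M h
    rw [← h, Measure.map_map (measurable_snocFun t) (by fun_prop)]
    congr 1
    ext1 x
    exact (snoc_proj N t x).symm
  -- first marginal of the glued plan
  have hfst : ∀ t ≤ N, (gluePlan S t).map Prod.fst = μ.map (proj N t) := by
    intro t
    induction t with
    | zero =>
      intro _
      have e1 : (Prod.fst : (Fin 0 → ℝ) × (Fin 0 → ℝ) → _) = fun _ => Fin.elim0 := by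
        ext1 z; exact Subsingleton.elim _ _
      have e2 : proj N 0 = fun _ => Fin.elim0 := by
        ext1 z; exact Subsingleton.elim _ _
      rw [e1, e2, Measure.map_const, Measure.map_const]
      simp
    | succ T ih =>
      intro hT
      obtain ⟨M, iM, hMt, hx⟩ := hxs T hT
      have h1 := gluePlan_restrict_step S T M hx T le_rfl univ .univ
      simp only [mem_univ, ofPred_true, Measure.restrict_univ] at h1
      rw [h1, ih (by omega), ← hmuStep T M hMt]
  have hdens : ∀ t, ∀ B : Set (Fin t → ℝ), MeasurableSet B → ∀ T, t ≤ T → T ≤ N →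
      ((gluePlan S T).restrict {p | proj T t p.2 ∈ B}).map Prod.fst
        = (μ.map (proj N T)).withDensity
          (fun x => (gluePlan S t).condKernel (proj T t x) B) := by
    intro t B hB T hT
    induction T, hT using Nat.le_induction with
    | base =>
      intro htN
      ext A hA
      have hd := (gluePlan S t).disintegrate (gluePlan S t).condKernel
      have hf1 : (gluePlan S t).fst = μ.map (proj N t) := hfst t htN
      rw [hf1] at hd
      simp only [proj_self]
      rw [Measure.map_apply measurable_fst hA, Measure.restrict_apply (measurable_fst hA),
        withDensity_apply _ hA, ← Measure.compProd_apply_prod hA hB, hd]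
      rfl
    | succ T hT ih =>
      intro hTN
      obtain ⟨M, iM, hMt, hx⟩ := hxs T hTN
      have hg : Measurable (fun x => (gluePlan S t).condKernel (proj T t x) B) :=
        (Kernel.measurable_coe _ hB).comp (measurable_proj T t)
      have hg' : Measurable (fun x => (gluePlan S t).condKernel (proj (T+1) t x) B) :=
        (Kernel.measurable_coe _ hB).comp (measurable_proj (T+1) t)
      rw [gluePlan_restrict_step S T M hx t hT B hB, ih (by omega),
        withDensity_compProd' _ _ hg, hmuStep T M hMt,
        ← map_withDensity_comp _ _ (measurable_snocFun T) _ hg']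
      simp only [proj_snoc T t hT]
  have hidN : proj N N = id := by ext1 x; exact proj_self N x
  have hidNN : pairProj N N = id := by ext1 z; simp [pairProj, proj_self]
  have hcoup : IsCoupling μ ν (gluePlan S N) := by
    constructor
    · rw [hfst N le_rfl, hidN, Measure.map_id]
    · have h1 : ((gluePlan S N).map (stateZ N)).map Prod.snd
          = (γ.map (fun p => stateZ N (pairProj N N p))).map Prod.snd := by
        rw [gluePlan_state S γ hS N]
      rw [Measure.map_map (by fun_prop) (by fun_prop), Measure.map_map (by fun_prop) (by fun_prop),
        hidNN] at h1
      exact h1.trans hγ.1.2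
  refine ⟨gluePlan S N, isCausal_of_density hcoup ?_, ?_, ?_⟩
  · intro t ht B hB
    refine ⟨fun x => (gluePlan S t).condKernel x B, Kernel.measurable_coe _ hB, ?_⟩
    rw [hdens t B hB N ht le_rfl, hidN, Measure.map_id]
  · intro t ht htN S' hS' hS'e
    refine ⟨S t, ?_⟩
    rw [gluePlan_step S N t htN, gluePlan_map_pairProj S N t htN.le] at hS'e
    rw [gluePlan_map_pairProj S N t htN.le]
    filter_upwards [ae_eq_of_compProd_eq_sfinite _ _ _ hS'e] with z hz
    rw [hz, Kernel.comap_apply]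
    have : 0 < t := ht
    simp [stateZ, lastOf, this]
  · have hcm : ∀ t, Measurable (fun p : Path N × Path N => c t (coord N (t - 1) p.1) (proj N t p.2)) :=
      fun t => (hc t).comp (by fun_prop :
        Measurable (fun p : Path N × Path N => (coord N (t - 1) p.1, proj N t p.2)))
    unfold semisepCost
    rw [lintegral_finsetSum _ (fun t _ => hcm t), lintegral_finsetSum _ (fun t _ => hcm t)]
    refine Finset.sum_congr rfl fun t ht => ?_
    obtain ⟨ht1, htN⟩ := Finset.mem_Icc.mp ht
    have hgen : ∀ m : Measure (Path N × Path N),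
        ∫⁻ p, c t (coord N (t - 1) p.1) (proj N t p.2) ∂m
          = ∫⁻ q, c t q.1 q.2 ∂((m.map (pairProj N t)).map (stateZ t)) := by
      intro m
      have hcz : Measurable (fun a => c t (stateZ t a).1 (stateZ t a).2) :=
        (hc t).comp (measurable_stateZ t)
      rw [lintegral_map (hc t) (by fun_prop), lintegral_map hcz (measurable_pairProj N t)]
      simp [stateZ, pairProj, lastOf_proj N t ht1]
    rw [hgen, hgen, gluePlan_map_pairProj S N t htN, gluePlan_state S γ hS t,
      Measure.map_map (by fun_prop) (by fun_prop)]
    rfl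

theorem causal_equals_quasi_markov
    (N : ℕ) (μ ν : Measure (Path N)) [IsProbabilityMeasure μ] [IsProbabilityMeasure ν]
    (hM : IsMarkovMeasure N μ)
    (c : (t : ℕ) → ℝ → (Fin t → ℝ) → ℝ≥0∞)
    (hc : ∀ t, Measurable (fun q : ℝ × (Fin t → ℝ) => c t q.1 q.2)) :
    ((⨅ (γ : Measure (Path N × Path N))
        (_ : IsCausal N μ ν γ) (_ : IsQuasiMarkov N γ), ∫⁻ p, semisepCost N c p ∂γ)
      = ⨅ (γ : Measure (Path N × Path N)) (_ : IsCausal N μ ν γ),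
          ∫⁻ p, semisepCost N c p ∂γ)
    ∧ ((∃ γ : Measure (Path N × Path N), IsCausal N μ ν γ ∧
          ∫⁻ p, semisepCost N c p ∂γ
            = ⨅ (γ' : Measure (Path N × Path N)) (_ : IsCausal N μ ν γ'),
                ∫⁻ p, semisepCost N c p ∂γ') →
        ∃ γ : Measure (Path N × Path N), IsCausal N μ ν γ ∧ IsQuasiMarkov N γ ∧
          ∫⁻ p, semisepCost N c p ∂γ
            = ⨅ (γ' : Measure (Path N × Path N)) (_ : IsCausal N μ ν γ'),
                ∫⁻ p, semisepCost N c p ∂γ') := by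
  have hinf : (⨅ (γ : Measure (Path N × Path N))
        (_ : IsCausal N μ ν γ) (_ : IsQuasiMarkov N γ), ∫⁻ p, semisepCost N c p ∂γ)
      = ⨅ (γ : Measure (Path N × Path N)) (_ : IsCausal N μ ν γ),
          ∫⁻ p, semisepCost N c p ∂γ := by
    apply le_antisymm
    · refine le_iInf₂ fun γ hγ => ?_
      obtain ⟨γ', h1, h2, h3⟩ := exists_quasiMarkov hM c hc γ hγ
      rw [← h3]
      exact iInf_le_of_le γ' (iInf₂_le_of_le h1 h2 le_rfl)
    · exact le_iInf fun γ => le_iInf₂ fun h1 _ => iInf₂_le γ h1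
  refine ⟨hinf, ?_⟩
  rintro ⟨γ, hγ, hopt⟩
  obtain ⟨γ', h1, h2, h3⟩ := exists_quasiMarkov hM c hc γ hγ
  exact ⟨γ', h1, h2, h3.trans hopt⟩

end CausalTransport
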